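/- arXiv:1506.01242 — 2 statements merged into one kernel-verified Lean document; each statement's English description precedes it below -/
import Mathlib

section
/- Assume Σ_{i=1}^N M_i ≤ μ(X) (saturation or under-saturation). Let 1 < β < 2 and λ ≥ 0 be constants and suppose β ψ_1(x) ≤ ψ̃_1(x) ≤ β ψ_1(x) + λ for every x ∈ X (keeping ψ_2, …, ψ_N and M unchanged), and assume the system (ψ̃_1, ψ_2, …, ψ_N) also satisfies assumptions (i) and (ii). Then P̃_1 ≥ P̄_1 − M_1 λ (2 − β) / (β − 1). -/
open MeasureTheory

/-- A feasible partition: measurable sets, capacity constraints, essentially disjoint. -/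
def Feasible {X : Type*} [MeasurableSpace X] (μ : Measure X) {N : ℕ}
    (M : Fin N → ℝ) (A : Fin N → Set X) : Prop :=
  (∀ i, MeasurableSet (A i)) ∧ (∀ i, μ (A i) ≤ ENNReal.ofReal (M i)) ∧
  Pairwise fun i j => μ (A i ∩ A j) = 0

/-- Total profit of a partition. -/
noncomputable def totalProfit {X : Type*} [MeasurableSpace X] (μ : Measure X) {N : ℕ}
    (ψ : Fin N → X → ℝ) (A : Fin N → Set X) : ℝ :=
  ∑ i, ∫ x in A i, ψ i x ∂μ

/-- The optimal total profit `Σ_ψ(M)`. -/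
noncomputable def SigmaOpt {X : Type*} [MeasurableSpace X] (μ : Measure X) {N : ℕ}
    (ψ : Fin N → X → ℝ) (M : Fin N → ℝ) : ℝ :=
  sSup {s | ∃ A, Feasible μ M A ∧ s = totalProfit μ ψ A}

/-- The dual functional `Ξ⁰_ψ(p) = ∫ max_i (ψ_i - p_i)_+ dμ`. -/
noncomputable def Xi0 {X : Type*} [MeasurableSpace X] (μ : Measure X) {N : ℕ}
    (ψ : Fin N → X → ℝ) (p : Fin N → ℝ) : ℝ :=
  ∫ x, (⨆ i, max (ψ i x - p i) 0) ∂μ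

/-- Consumers giving up all agents at prices `p`. -/
def Aplus0 {X : Type*} {N : ℕ} (ψ : Fin N → X → ℝ) (p : Fin N → ℝ) : Set X :=
  {x | ∀ i, ψ i x ≤ p i}

/-- Consumers preferring agent `i` at prices `p`. -/
def Aplus {X : Type*} {N : ℕ} (ψ : Fin N → X → ℝ) (p : Fin N → ℝ) (i : Fin N) : Set X :=
  {x | ∀ j, ψ j x - p j ≤ ψ i x - p i} \ Aplus0 ψ p

/-- A continuous real function on a compact space is integrable for every finite Borel measure. -/
lemma Continuous.integrable_of_compactSpace_of_isFiniteMeasure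
    {X : Type*} [TopologicalSpace X] [CompactSpace X] [MeasurableSpace X] [BorelSpace X]
    (μ : Measure X) [IsFiniteMeasure μ] {f : X → ℝ} (hf : Continuous f) : Integrable f μ := by
  obtain ⟨C, hC⟩ := isCompact_univ.exists_bound_of_continuousOn hf.continuousOn
  exact Integrable.of_bound hf.measurable.aestronglyMeasurable C
    (Filter.Eventually.of_forall fun x => hC x (Set.mem_univ x))

/-- The profit of a feasible partition is at most the optimal total profit. -/
lemma Feasible.totalProfit_le_sigmaOpt {X : Type*} [MeasurableSpace X] {μ : Measure X} {N : ℕ}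
    {ψ : Fin N → X → ℝ} {M : Fin N → ℝ} {A : Fin N → Set X}
    (hA : Feasible μ M A) (hψ : ∀ i, Integrable (ψ i) μ) :
    totalProfit μ ψ A ≤ SigmaOpt μ ψ M := by
  refine le_csSup ⟨∑ i, ∫ x, |ψ i x| ∂μ, ?_⟩ ⟨A, hA, rfl⟩
  rintro s ⟨B, -, rfl⟩
  refine Finset.sum_le_sum fun i _ => ?_
  calc ∫ x in B i, ψ i x ∂μ ≤ ∫ x in B i, |ψ i x| ∂μ :=
        integral_mono (hψ i).integrableOn (hψ i).abs.integrableOn fun x => le_abs_self _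
    _ ≤ ∫ x, |ψ i x| ∂μ :=
        setIntegral_le_integral (hψ i).abs (Filter.Eventually.of_forall fun x => abs_nonneg _)

/-- Theorem `new1` (i): if `β ψ₁ ≤ ψ̃₁ ≤ β ψ₁ + λ` with `1 < β < 2`,
then in the saturated/under-saturated case `P̃₁ ≥ P̄₁ − M₁ λ (2−β)/(β−1)`. -/
theorem individual_value_decrease_bound
    {X : Type*} [TopologicalSpace X] [CompactSpace X] [T2Space X]
    [MeasurableSpace X] [BorelSpace X]
    (μ : Measure X) [IsProbabilityMeasure μ]
    {N : ℕ}
    (ψ : Fin (N + 1) → X → ℝ) (hψc : ∀ i, Continuous (ψ i))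
    (hpos : ∀ i, μ {x | ψ i x ≤ 0} = 0)
    (htwist : ∀ i j, i ≠ j → ∀ r : ℝ, μ {x | ψ i x - ψ j x = r} = 0)
    (M : Fin (N + 1) → ℝ) (hM : ∀ i, 0 < M i) (hsat : ∑ i, M i ≤ 1)
    (β lam : ℝ) (hβ₁ : 1 < β) (hβ₂ : β < 2) (hlam : 0 ≤ lam)
    (ψt : Fin (N + 1) → X → ℝ) (hψtc : ∀ i, Continuous (ψt i))
    (hkeep : ∀ i, i ≠ 0 → ψt i = ψ i)
    (hlb : ∀ x, β * ψ 0 x ≤ ψt 0 x)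
    (hub : ∀ x, ψt 0 x ≤ β * ψ 0 x + lam)
    (hpos' : ∀ i, μ {x | ψt i x ≤ 0} = 0)
    (htwist' : ∀ i j, i ≠ j → ∀ r : ℝ, μ {x | ψt i x - ψt j x = r} = 0)
    (Abar Atil : Fin (N + 1) → Set X)
    (hAbarF : Feasible μ M Abar) (hAbarOpt : totalProfit μ ψ Abar = SigmaOpt μ ψ M)
    (hAtilF : Feasible μ M Atil) (hAtilOpt : totalProfit μ ψt Atil = SigmaOpt μ ψt M) :
    (∫ x in Abar 0, ψ 0 x ∂μ) - M 0 * lam * (2 - β) / (β - 1) ≤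
      ∫ x in Atil 0, ψt 0 x ∂μ := by
  have hint (i) : Integrable (ψ i) μ := (hψc i).integrable_of_compactSpace_of_isFiniteMeasure μ
  have hintt (i) : Integrable (ψt i) μ := (hψtc i).integrable_of_compactSpace_of_isFiniteMeasure μ
  have hopt : totalProfit μ ψ Atil ≤ totalProfit μ ψ Abar :=
    hAbarOpt ▸ hAtilF.totalProfit_le_sigmaOpt hint
  have hoptt : totalProfit μ ψt Abar ≤ totalProfit μ ψt Atil :=
    hAtilOpt ▸ hAbarF.totalProfit_le_sigmaOpt hintt
  have hkeep' (i : Fin N) : ψt i.succ = ψ i.succ := hkeep _ i.succ_ne_zero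
  simp only [totalProfit, Fin.sum_univ_succ, hkeep'] at hopt hoptt
  have hbar : β * ∫ x in Abar 0, ψ 0 x ∂μ ≤ ∫ x in Abar 0, ψt 0 x ∂μ := by
    rw [← integral_const_mul]
    exact integral_mono ((hint 0).integrableOn.const_mul β) (hintt 0).integrableOn hlb
  have hvol : μ.real (Atil 0) ≤ M 0 := by
    simpa [Measure.real, (hM 0).le] using
      ENNReal.toReal_mono ENNReal.ofReal_ne_top (hAtilF.2.1 0)
  have htil : ∫ x in Atil 0, ψt 0 x ∂μ ≤ β * (∫ x in Atil 0, ψ 0 x ∂μ) + M 0 * lam := by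
    calc ∫ x in Atil 0, ψt 0 x ∂μ ≤ ∫ x in Atil 0, (β * ψ 0 x + lam) ∂μ :=
          integral_mono (hintt 0).integrableOn
            (((hint 0).integrableOn.const_mul β).add (integrable_const lam)) hub
      _ = β * (∫ x in Atil 0, ψ 0 x ∂μ) + μ.real (Atil 0) * lam := by
          rw [integral_add ((hint 0).integrableOn.const_mul β) (integrable_const lam),
            integral_const_mul, setIntegral_const, smul_eq_mul]
      _ ≤ _ := by gcongr
  have hnonneg : 0 ≤ ∫ x in Atil 0, ψ 0 x ∂μ := by
    have hae : ∀ᵐ x ∂μ, 0 < ψ 0 x := by simpa [ae_iff] using hpos 0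
    exact setIntegral_nonneg_of_ae (hae.mono fun x hx => hx.le)
  have hβ : 0 < β - 1 := by linarith
  rw [sub_le_iff_le_add, ← sub_le_iff_le_add', le_div_iff₀ hβ]
  generalize (∫ x in Abar 0, ψ 0 x ∂μ) = a at *
  generalize (∫ x in Abar 0, ψt 0 x ∂μ) = b at *
  generalize (∫ x in Atil 0, ψ 0 x ∂μ) = c at *
  generalize (∫ x in Atil 0, ψt 0 x ∂μ) = d at *
  have hexch : b - a ≤ d - c := by linarith
  nlinarith [mul_nonneg (sub_nonneg.2 hβ₂.le) (sub_nonneg.2 htil),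
    mul_nonneg (mul_nonneg hβ.le hβ.le) hnonneg]
end

section
/- Coalition duality: assume additionally that (iii) μ{x : ψ_i(x) = r} = 0 for every i and r, and that Σ_{i=1}^N M_i ≤ μ(X). Let J_1, …, J_k be nonempty pairwise disjoint subsets of {1,…,N} with J_1 ∪ … ∪ J_k = {1,…,N}, and define the coalition wisdoms ψ_{J_l}(x) := max_{i ∈ J_l} ψ_i(x) and coalition capacities M_{J_l} := Σ_{i ∈ J_l} M_i. Then: (a) for every l ≠ l' and every r ∈ ℝ, μ{x : ψ_{J_l}(x) − ψ_{J_{l'}}(x) = r} = 0 and μ{x : ψ_{J_l}(x) = r} = 0; (b) the coalition total profit satisfies the duality Σ_{ψ_𝒥}(M_𝒥) = min_{q ∈ ℝ^k} ( ∫_X max_{1≤l≤k} max(ψ_{J_l}(x) − q_l, 0) dμ(x) + Σ_{l=1}^k q_l M_{J_l} ), the minimum being attained; and (c) the feasible partition attaining Σ_{ψ_𝒥}(M_𝒥) is unique up to μ-null sets. -/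
open MeasureTheory

/-- The surplus `max_i (φ_i - q_i)_+` of a consumer at prices `q`. -/
noncomputable def surplus {X : Type*} {k : ℕ} (φ : Fin k → X → ℝ) (q : Fin k → ℝ) (x : X) : ℝ :=
  ⨆ i, max (φ i x - q i) 0

/-- Consumers strictly preferring agent `l` to every other agent and to giving up. -/
def strictDemand {X : Type*} {k : ℕ} (φ : Fin k → X → ℝ) (q : Fin k → ℝ) (l : Fin k) : Set X :=
  {x | 0 < φ l x - q l ∧ ∀ j, j ≠ l → φ j x - q j < φ l x - q l}

section Pointwise

variable {X : Type*} {k : ℕ} {φ : Fin k → X → ℝ} {q : Fin k → ℝ} {x : X}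

lemma max_le_surplus (i : Fin k) : max (φ i x - q i) 0 ≤ surplus φ q x :=
  le_ciSup (f := fun i => max (φ i x - q i) 0) (Set.finite_range _).bddAbove i

lemma sub_le_surplus (i : Fin k) : φ i x - q i ≤ surplus φ q x :=
  (le_max_left _ _).trans (max_le_surplus i)

lemma surplus_nonneg : 0 ≤ surplus φ q x :=
  Real.iSup_nonneg fun _ => le_max_right _ _

lemma surplus_le {c : ℝ} (hc : 0 ≤ c) (h : ∀ i, φ i x - q i ≤ c) : surplus φ q x ≤ c :=
  Real.iSup_le (fun i => max_le (h i) hc) hc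

lemma surplus_eq_zero_or [Nonempty (Fin k)] :
    surplus φ q x = 0 ∨ ∃ i, surplus φ q x = φ i x - q i := by
  obtain ⟨i, hi⟩ := exists_eq_ciSup_of_finite (f := fun i => max (φ i x - q i) 0)
  change max (φ i x - q i) 0 = surplus φ q x at hi
  rcases max_choice (φ i x - q i) 0 with h | h
  · exact Or.inr ⟨i, by rw [← hi, h]⟩
  · exact Or.inl (by rw [← hi, h])

lemma surplus_le_add {q' : Fin k → ℝ} {c : ℝ} (hc : 0 ≤ c) (h : ∀ i, q' i - q i ≤ c) :
    surplus φ q x ≤ surplus φ q' x + c := by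
  refine surplus_le (add_nonneg surplus_nonneg hc) fun i => ?_
  linarith [h i, sub_le_surplus (φ := φ) (q := q') (x := x) i]

lemma abs_surplus_sub_le {q' : Fin k → ℝ} {c : ℝ} (hc : 0 ≤ c) (h : ∀ i, |q i - q' i| ≤ c) :
    |surplus φ q x - surplus φ q' x| ≤ c := by
  have h₁ := surplus_le_add (φ := φ) (x := x) hc fun i => (abs_le.1 (h i)).2
  have h₂ := surplus_le_add (φ := φ) (q := q) (q' := q') (x := x) hc
    fun i => by linarith [(abs_le.1 (h i)).1]
  rw [abs_le]
  constructor <;> linarith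

lemma surplus_of_mem_strictDemand {l : Fin k} (hx : x ∈ strictDemand φ q l) :
    surplus φ q x = φ l x - q l := by
  refine le_antisymm (surplus_le hx.1.le fun j => ?_) (sub_le_surplus l)
  rcases eq_or_ne j l with rfl | hj
  · exact le_rfl
  · exact (hx.2 j hj).le

lemma mem_strictDemand_of_surplus_le {l : Fin k} (h0 : φ l x ≠ q l)
    (hne : ∀ j, j ≠ l → φ j x - q j ≠ φ l x - q l) (h : surplus φ q x ≤ φ l x - q l) :
    x ∈ strictDemand φ q l :=
  ⟨lt_of_le_of_ne (surplus_nonneg.trans h) (sub_ne_zero.2 h0).symm,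
    fun j hj => lt_of_le_of_ne ((sub_le_surplus j).trans h) (hne j hj)⟩

lemma disjoint_strictDemand {l l' : Fin k} (h : l ≠ l') :
    Disjoint (strictDemand φ q l) (strictDemand φ q l') :=
  Set.disjoint_left.2 fun _ hx hx' => lt_asymm (hx.2 l' h.symm) (hx'.2 l h)

/-- Off the ties, the surplus is differentiable in the price of agent `l`. -/
lemma hasDerivAt_surplus [Nonempty (Fin k)] {l : Fin k} (h0 : φ l x ≠ q l)
    (hne : ∀ j, j ≠ l → φ j x - q j ≠ φ l x - q l) :
    HasDerivAt (fun s : ℝ => surplus φ (q + Pi.single l s) x)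
      ((strictDemand φ q l).indicator (fun _ => (-1 : ℝ)) x) 0 := by
  by_cases hx : x ∈ strictDemand φ q l
  · rw [Set.indicator_of_mem hx]
    have hev : ∀ᶠ s : ℝ in nhds 0, x ∈ strictDemand φ (q + Pi.single l s) l := by
      have e0 : ∀ᶠ s : ℝ in nhds 0, s < φ l x - q l := eventually_lt_nhds hx.1
      have e1 : ∀ᶠ s : ℝ in nhds 0, ∀ j, j ≠ l → s < (φ l x - q l) - (φ j x - q j) := by
        refine Filter.eventually_all.2 fun j => ?_
        by_cases hj : j = l
        · simp [hj]
        · filter_upwards [eventually_lt_nhds (sub_pos.2 (hx.2 j hj))] with s hs _ using hs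
      filter_upwards [e0, e1] with s hs hs'
      refine ⟨?_, fun j hj => ?_⟩
      · simp only [Pi.add_apply, Pi.single_eq_same]
        linarith
      · simp only [Pi.add_apply, Pi.single_eq_same, Pi.single_eq_of_ne hj]
        linarith [hs' j hj]
    have hd : HasDerivAt (fun s : ℝ => (φ l x - q l) - s) (-1) 0 :=
      (hasDerivAt_id (0 : ℝ)).const_sub _
    refine hd.congr_of_eventuallyEq ?_
    filter_upwards [hev] with s hs
    rw [surplus_of_mem_strictDemand hs]
    simp only [Pi.add_apply, Pi.single_eq_same]
    ring
  · rw [Set.indicator_of_notMem hx]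
    have hlt : φ l x - q l < surplus φ q x := by
      by_contra! h
      exact hx (mem_strictDemand_of_surplus_le h0 hne h)
    refine (hasDerivAt_const (0 : ℝ) (surplus φ q x)).congr_of_eventuallyEq ?_
    have e0 : ∀ᶠ s : ℝ in nhds 0, (φ l x - q l) - surplus φ q x < s :=
      eventually_gt_nhds (sub_neg.2 hlt)
    filter_upwards [e0] with s hs
    apply le_antisymm
    · refine surplus_le surplus_nonneg fun j => ?_
      rcases eq_or_ne j l with rfl | hj
      · simp only [Pi.add_apply, Pi.single_eq_same]
        linarith
      · simpa [Pi.single_eq_of_ne hj] using sub_le_surplus (φ := φ) (q := q) (x := x) j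
    · rcases surplus_eq_zero_or (φ := φ) (q := q) (x := x) with h | ⟨i, hi⟩
      · rw [h]
        exact surplus_nonneg
      · have hil : i ≠ l := by
          rintro rfl
          exact hlt.ne' hi
        rw [hi]
        have h := sub_le_surplus (φ := φ) (q := q + Pi.single l s) (x := x) i
        rwa [Pi.add_apply, Pi.single_eq_of_ne hil, add_zero] at h

end Pointwise

section Partition

variable {X : Type*} [MeasurableSpace X] {μ : Measure X} {k : ℕ} {φ : Fin k → X → ℝ}

lemma ae_no_tie (htwist : ∀ i j, i ≠ j → ∀ r : ℝ, μ {x | φ i x - φ j x = r} = 0)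
    (hlevel : ∀ i (r : ℝ), μ {x | φ i x = r} = 0) (q : Fin k → ℝ) :
    ∀ᵐ x ∂μ, ∀ l, φ l x ≠ q l ∧ ∀ j, j ≠ l → φ j x - q j ≠ φ l x - q l := by
  rw [ae_all_iff]
  intro l
  refine Filter.Eventually.and (measure_eq_zero_iff_ae_notMem.1 (hlevel l (q l))) ?_
  rw [ae_all_iff]
  intro j
  by_cases hj : j = l
  · simp [hj]
  · have h : ∀ᵐ x ∂μ, ¬ φ j x - φ l x = q j - q l :=
      measure_eq_zero_iff_ae_notMem.1 (htwist j l hj (q j - q l))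
    filter_upwards [h] with x hx _ heq
    exact hx (by linarith)

lemma ae_sum_indicator {m : Fin k → ℝ} {B : Fin k → Set X} (hB : Feasible μ m B)
    (q : Fin k → ℝ) :
    ∀ᵐ x ∂μ, (∀ l, x ∈ B l → ∑ j, (B j).indicator (fun x => φ j x - q j) x = φ l x - q l) ∧
      ((∀ l, x ∉ B l) → ∑ j, (B j).indicator (fun x => φ j x - q j) x = 0) := by
  have h : ∀ᵐ x ∂μ, ∀ i j, i ≠ j → x ∉ B i ∩ B j := by
    simp only [ae_all_iff]
    exact fun i j hij => measure_eq_zero_iff_ae_notMem.1 (hB.2.2 hij)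
  filter_upwards [h] with x hx
  refine ⟨fun l hl => ?_, fun hn => Finset.sum_eq_zero fun j _ => Set.indicator_of_notMem (hn j) _⟩
  rw [Finset.sum_eq_single_of_mem l (Finset.mem_univ l) fun j _ hj =>
    Set.indicator_of_notMem (fun hjx => hx j l hj ⟨hjx, hl⟩) _, Set.indicator_of_mem hl]

lemma ae_sum_indicator_le_surplus {m : Fin k → ℝ} {B : Fin k → Set X} (hB : Feasible μ m B)
    (q : Fin k → ℝ) :
    ∀ᵐ x ∂μ, ∑ j, (B j).indicator (fun x => φ j x - q j) x ≤ surplus φ q x := by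
  filter_upwards [ae_sum_indicator (φ := φ) hB q] with x hx
  by_cases h : ∃ l, x ∈ B l
  · obtain ⟨l, hl⟩ := h
    rw [hx.1 l hl]
    exact sub_le_surplus l
  · rw [hx.2 (not_exists.1 h)]
    exact surplus_nonneg

lemma sum_mul_measureReal_le {m q : Fin k → ℝ} (hm : ∀ i, 0 ≤ m i)
    (hq : ∀ i, 0 ≤ q i) {B : Fin k → Set X} (hB : Feasible μ m B) :
    ∑ l, q l * μ.real (B l) ≤ ∑ l, q l * m l :=
  Finset.sum_le_sum fun l _ => mul_le_mul_of_nonneg_left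
    (ENNReal.toReal_le_of_le_ofReal (hm l) (hB.2.1 l)) (hq l)

end Partition

section Topological

variable {X : Type*} [TopologicalSpace X] {k : ℕ} {φ : Fin k → X → ℝ}

lemma continuous_surplus_uncurry [Nonempty (Fin k)] (hφ : ∀ i, Continuous (φ i)) :
    Continuous fun p : (Fin k → ℝ) × X => surplus φ p.1 p.2 := by
  have h : (fun p : (Fin k → ℝ) × X => surplus φ p.1 p.2) = fun p =>
      Finset.univ.sup' Finset.univ_nonempty fun i => max (φ i p.2 - p.1 i) 0 := by
    funext p
    rw [Finset.sup'_univ_eq_ciSup]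
    rfl
  rw [h]
  refine Continuous.finset_sup'_apply _ fun i _ => ?_
  have := hφ i
  fun_prop

lemma continuous_surplus [Nonempty (Fin k)] (hφ : ∀ i, Continuous (φ i)) (q : Fin k → ℝ) :
    Continuous (surplus φ q) :=
  (continuous_surplus_uncurry hφ).comp (Continuous.prodMk_right q)

variable [MeasurableSpace X] [BorelSpace X]

lemma measurableSet_strictDemand (hφ : ∀ i, Continuous (φ i)) (q : Fin k → ℝ) (l : Fin k) :
    MeasurableSet (strictDemand φ q l) := by
  have hm : ∀ i, Measurable fun x => φ i x - q i := fun i => (hφ i).measurable.sub_const _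
  refine (measurableSet_lt measurable_const (hm l)).inter ?_
  change MeasurableSet {x | ∀ j, j ≠ l → φ j x - q j < φ l x - q l}
  simp only [Set.ofPred_forall]
  exact MeasurableSet.iInter fun j => MeasurableSet.iInter fun _ => measurableSet_lt (hm j) (hm l)

lemma feasible_strictDemand {μ : Measure X} [IsFiniteMeasure μ]
    (hφ : ∀ i, Continuous (φ i)) {m q : Fin k → ℝ}
    (hA : ∀ l, μ.real (strictDemand φ q l) = m l) : Feasible μ m (strictDemand φ q) := by
  refine ⟨measurableSet_strictDemand hφ q, fun l => ?_, fun i j hij => ?_⟩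
  · rw [← hA l, ofReal_measureReal]
  · change μ (_ ∩ _) = 0
    rw [(disjoint_strictDemand hij).inter_eq, measure_empty]

lemma integrable_of_continuous_compactSpace [CompactSpace X] {μ : Measure X} [IsFiniteMeasure μ]
    {f : X → ℝ} (hf : Continuous f) : Integrable f μ :=
  hf.integrable_of_hasCompactSupport (HasCompactSupport.of_compactSpace f)

end Topological

section Duality

variable {X : Type*} [TopologicalSpace X] [CompactSpace X] [MeasurableSpace X] [BorelSpace X]
  {μ : Measure X} {k : ℕ} {φ : Fin k → X → ℝ}

lemma totalProfit_eq [IsFiniteMeasure μ] (hφ : ∀ i, Continuous (φ i)) (q : Fin k → ℝ)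
    {B : Fin k → Set X} (hB : ∀ i, MeasurableSet (B i)) :
    totalProfit μ φ B = (∫ x, ∑ l, (B l).indicator (fun x => φ l x - q l) x ∂μ)
      + ∑ l, q l * μ.real (B l) := by
  have hi : ∀ l, Integrable (fun x => φ l x - q l) μ := fun l =>
    integrable_of_continuous_compactSpace ((hφ l).sub continuous_const)
  rw [integral_finsetSum _ fun l _ => (hi l).indicator (hB l), ← Finset.sum_add_distrib]
  refine Finset.sum_congr rfl fun l _ => ?_
  rw [integral_indicator (hB l), integral_sub
    (integrable_of_continuous_compactSpace (hφ l)).integrableOn (integrable_const _).integrableOn,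
    setIntegral_const, smul_eq_mul]
  ring

lemma integrable_sum_indicator [IsFiniteMeasure μ] (hφ : ∀ i, Continuous (φ i)) (q : Fin k → ℝ)
    {B : Fin k → Set X} (hB : ∀ i, MeasurableSet (B i)) :
    Integrable (fun x => ∑ l, (B l).indicator (fun x => φ l x - q l) x) μ :=
  integrable_finsetSum _ fun l _ => (integrable_of_continuous_compactSpace
    ((hφ l).sub continuous_const)).indicator (hB l)

variable [Nonempty (Fin k)]

lemma integrable_surplus [IsFiniteMeasure μ] (hφ : ∀ i, Continuous (φ i)) (q : Fin k → ℝ) :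
    Integrable (surplus φ q) μ :=
  integrable_of_continuous_compactSpace (continuous_surplus hφ q)

lemma continuous_Xi0 [IsProbabilityMeasure μ] (hφ : ∀ i, Continuous (φ i)) :
    Continuous (Xi0 μ φ) := by
  refine LipschitzWith.continuous (K := 1) (LipschitzWith.of_dist_le_mul fun q q' => ?_)
  change dist (∫ x, surplus φ q x ∂μ) (∫ x, surplus φ q' x ∂μ) ≤ _
  rw [dist_eq_norm, ← integral_sub (integrable_surplus hφ q) (integrable_surplus hφ q')]
  have h := norm_integral_le_of_norm_le_const (μ := μ) (C := dist q q')
    (f := fun x => surplus φ q x - surplus φ q' x) (Filter.Eventually.of_forall fun x => by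
      rw [Real.norm_eq_abs]
      refine abs_surplus_sub_le dist_nonneg fun i => ?_
      rw [← Real.dist_eq]
      exact dist_le_pi_dist q q' i)
  simpa using h

/-- The dual functional attains its minimum over all prices at nonnegative prices. -/
lemma exists_nonneg_dual_minimizer [IsProbabilityMeasure μ] (hφ : ∀ i, Continuous (φ i))
    (hpos : ∀ i, μ {x | φ i x ≤ 0} = 0) {m : Fin k → ℝ} (hm : ∀ i, 0 ≤ m i)
    (hsat : ∑ i, m i ≤ 1) :
    ∃ q₀ : Fin k → ℝ, (∀ i, 0 ≤ q₀ i) ∧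
      ∀ q, Xi0 μ φ q₀ + ∑ l, q₀ l * m l ≤ Xi0 μ φ q + ∑ l, q l * m l := by
  have hbound : ∃ C : ℝ, 0 ≤ C ∧ ∀ i x, φ i x ≤ C := by
    have hc : ∀ i, ∃ C, ∀ x, φ i x ≤ C := fun i => by
      obtain ⟨C, hC⟩ := (isCompact_range (hφ i)).bddAbove
      exact ⟨C, fun x => hC ⟨x, rfl⟩⟩
    choose c hc using hc
    refine ⟨∑ i, |c i|, Finset.sum_nonneg fun _ _ => abs_nonneg _, fun i x => ?_⟩
    exact (hc i x).trans ((le_abs_self _).trans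
      (Finset.single_le_sum (f := fun i => |c i|) (fun _ _ => abs_nonneg _) (Finset.mem_univ i)))
  obtain ⟨C, hC0, hC⟩ := hbound
  have hcont : Continuous fun q : Fin k → ℝ => Xi0 μ φ q + ∑ l, q l * m l := by
    have := continuous_Xi0 (μ := μ) hφ
    fun_prop
  obtain ⟨q₀, hq₀, hmin⟩ := (isCompact_Icc (a := (0 : Fin k → ℝ)) (b := fun _ => C)).exists_isMinOn
    ⟨0, le_rfl, fun _ => hC0⟩ hcont.continuousOn
  refine ⟨q₀, hq₀.1, fun q => ?_⟩
  obtain ⟨i₀, hi₀⟩ := Finite.exists_min q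
  set t : ℝ := max (-q i₀) 0 with ht
  have ht0 : 0 ≤ t := le_max_right _ _
  set q' : Fin k → ℝ := fun i => min (q i + t) C with hq'
  have hq'mem : q' ∈ Set.Icc (0 : Fin k → ℝ) fun _ => C := by
    refine ⟨fun i => le_min ?_ hC0, fun i => min_le_right _ _⟩
    simp only [Pi.zero_apply]
    linarith [hi₀ i, le_max_left (-q i₀) 0]
  refine (hmin hq'mem).trans ?_
  have hpt : ∀ᵐ x ∂μ, surplus φ q' x ≤ surplus φ q x - t := by
    have hp : ∀ᵐ x ∂μ, ¬ φ i₀ x ≤ 0 := measure_eq_zero_iff_ae_notMem.1 (hpos i₀)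
    filter_upwards [hp] with x hx
    have hts : t ≤ surplus φ q x := by
      refine max_le ?_ surplus_nonneg
      linarith [sub_le_surplus (φ := φ) (q := q) (x := x) i₀]
    refine surplus_le (sub_nonneg.2 hts) fun i => ?_
    simp only [hq']
    rcases min_choice (q i + t) C with h | h <;> rw [h]
    · linarith [sub_le_surplus (φ := φ) (q := q) (x := x) i]
    · linarith [hC i x]
  have hX : Xi0 μ φ q' ≤ Xi0 μ φ q - t := by
    have h := integral_mono_ae (integrable_surplus hφ q')
      ((integrable_surplus (μ := μ) hφ q).sub (integrable_const t)) hpt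
    rw [integral_sub' (integrable_surplus hφ q) (integrable_const t), integral_const,
      probReal_univ, one_smul] at h
    exact h
  have hS : ∑ l, q' l * m l ≤ ∑ l, q l * m l + t * ∑ l, m l := by
    rw [Finset.mul_sum, ← Finset.sum_add_distrib]
    refine Finset.sum_le_sum fun l _ => ?_
    rw [← add_mul]
    exact mul_le_mul_of_nonneg_right (min_le_left _ _) (hm l)
  linarith [mul_le_of_le_one_right ht0 hsat]

/-- At dual optimal prices, strict demand exhausts every capacity. -/
lemma measureReal_strictDemand_of_minimizer [IsProbabilityMeasure μ] (hφ : ∀ i, Continuous (φ i))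
    {m q : Fin k → ℝ}
    (htie : ∀ᵐ x ∂μ, ∀ l, φ l x ≠ q l ∧ ∀ j, j ≠ l → φ j x - q j ≠ φ l x - q l)
    (hmin : ∀ q', Xi0 μ φ q + ∑ l, q l * m l ≤ Xi0 μ φ q' + ∑ l, q' l * m l) (l : Fin k) :
    μ.real (strictDemand φ q l) = m l := by
  have hA := measurableSet_strictDemand hφ q l
  have hlip : ∀ x, LipschitzOnWith (Real.nnabs 1)
      (fun s : ℝ => surplus φ (q + Pi.single l s) x) Set.univ := fun x => by
    refine (LipschitzWith.of_dist_le_mul fun s s' => ?_).lipschitzOnWith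
    rw [map_one, NNReal.coe_one, one_mul, Real.dist_eq]
    refine abs_surplus_sub_le dist_nonneg fun i => ?_
    rcases eq_or_ne i l with rfl | hi
    · simp [Real.dist_eq]
    · simp [Pi.single_eq_of_ne hi]
  have hpt : ∀ᵐ x ∂μ, HasDerivAt (fun s : ℝ => surplus φ (q + Pi.single l s) x)
      ((strictDemand φ q l).indicator (fun _ => (-1 : ℝ)) x) 0 := by
    filter_upwards [htie] with x hx using hasDerivAt_surplus (hx l).1 (hx l).2
  have hderiv : HasDerivAt (fun s : ℝ => ∫ x, surplus φ (q + Pi.single l s) x ∂μ)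
      (∫ x, (strictDemand φ q l).indicator (fun _ => (-1 : ℝ)) x ∂μ) 0 :=
    (hasDerivAt_integral_of_dominated_loc_of_lip (bound := fun _ => (1 : ℝ)) Filter.univ_mem
      (Filter.Eventually.of_forall fun s => (integrable_surplus hφ _).aestronglyMeasurable)
      (integrable_surplus hφ _) (aestronglyMeasurable_const.indicator hA)
      (Filter.Eventually.of_forall hlip) (integrable_const _) hpt).2
  have hint : ∫ x, (strictDemand φ q l).indicator (fun _ => (-1 : ℝ)) x ∂μ
      = -μ.real (strictDemand φ q l) := by
    rw [integral_indicator hA, setIntegral_const]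
    simp
  rw [hint] at hderiv
  have hlin : HasDerivAt (fun s : ℝ => (∑ j, q j * m j) + s * m l) (1 * m l) 0 :=
    ((hasDerivAt_id (0 : ℝ)).mul_const (m l)).const_add _
  have hlocal : IsLocalMin (fun s : ℝ => (∫ x, surplus φ (q + Pi.single l s) x ∂μ)
      + ((∑ j, q j * m j) + s * m l)) 0 := by
    refine Filter.Eventually.of_forall fun s => ?_
    have h := hmin (q + Pi.single l s)
    have hs : ∑ j, (q + Pi.single l s : Fin k → ℝ) j * m j = (∑ j, q j * m j) + s * m l := by
      simp [add_mul, Finset.sum_add_distrib, Pi.single_apply]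
    rw [hs] at h
    simpa [Xi0, surplus] using h
  have := hlocal.hasDerivAt_eq_zero (hderiv.add hlin)
  linarith

/-- Weak duality. -/
lemma totalProfit_le_dual [IsFiniteMeasure μ] (hφ : ∀ i, Continuous (φ i)) {m q : Fin k → ℝ}
    (hm : ∀ i, 0 ≤ m i) (hq : ∀ i, 0 ≤ q i) {B : Fin k → Set X} (hB : Feasible μ m B) :
    totalProfit μ φ B ≤ Xi0 μ φ q + ∑ l, q l * m l := by
  rw [totalProfit_eq hφ q hB.1]
  exact add_le_add (integral_mono_ae (integrable_sum_indicator hφ q hB.1) (integrable_surplus hφ q)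
    (ae_sum_indicator_le_surplus hB q)) (sum_mul_measureReal_le hm hq hB)

lemma totalProfit_strictDemand [IsFiniteMeasure μ] (hφ : ∀ i, Continuous (φ i)) {m q : Fin k → ℝ}
    (htie : ∀ᵐ x ∂μ, ∀ l, φ l x ≠ q l ∧ ∀ j, j ≠ l → φ j x - q j ≠ φ l x - q l)
    (hA : ∀ l, μ.real (strictDemand φ q l) = m l) :
    totalProfit μ φ (strictDemand φ q) = Xi0 μ φ q + ∑ l, q l * m l := by
  have hf := feasible_strictDemand hφ hA
  rw [totalProfit_eq hφ q hf.1]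
  simp only [hA]
  congr 1
  refine integral_congr_ae ?_
  filter_upwards [htie, ae_sum_indicator (φ := φ) hf q] with x hx hs
  change _ = surplus φ q x
  rcases surplus_eq_zero_or (φ := φ) (q := q) (x := x) with h | ⟨i, hi⟩
  · rw [h]
    refine hs.2 fun l hl => ?_
    rw [surplus_of_mem_strictDemand hl] at h
    exact hl.1.ne' h
  · rw [hi]
    exact hs.1 i (mem_strictDemand_of_surplus_le (hx i).1 (hx i).2 hi.le)

/-- A feasible partition without duality gap agrees almost everywhere with strict demand. -/
lemma ae_mem_iff_of_totalProfit_eq [IsFiniteMeasure μ] (hφ : ∀ i, Continuous (φ i))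
    {m q : Fin k → ℝ} (hm : ∀ i, 0 ≤ m i) (hq : ∀ i, 0 ≤ q i)
    (htie : ∀ᵐ x ∂μ, ∀ l, φ l x ≠ q l ∧ ∀ j, j ≠ l → φ j x - q j ≠ φ l x - q l)
    {B : Fin k → Set X} (hB : Feasible μ m B)
    (heq : totalProfit μ φ B = Xi0 μ φ q + ∑ l, q l * m l) :
    ∀ᵐ x ∂μ, ∀ l, x ∈ B l ↔ x ∈ strictDemand φ q l := by
  have hle := ae_sum_indicator_le_surplus (φ := φ) hB q
  have hint := integrable_sum_indicator (μ := μ) hφ q hB.1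
  have hint_eq : ∫ x, ∑ l, (B l).indicator (fun x => φ l x - q l) x ∂μ
      = ∫ x, surplus φ q x ∂μ := by
    refine le_antisymm (integral_mono_ae hint (integrable_surplus hφ q) hle) ?_
    rw [totalProfit_eq hφ q hB.1] at heq
    have h := sum_mul_measureReal_le hm hq hB
    change _ = (∫ x, surplus φ q x ∂μ) + _ at heq
    linarith
  have hae := (integral_eq_iff_of_ae_le hint (integrable_surplus hφ q) hle).1 hint_eq
  filter_upwards [hae, htie, ae_sum_indicator (φ := φ) hB q] with x hx ht hs l
  have hmem : ∀ j, x ∈ B j → x ∈ strictDemand φ q j := fun j hj =>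
    mem_strictDemand_of_surplus_le (ht j).1 (ht j).2 (by rw [← hx, hs.1 j hj])
  refine ⟨hmem l, fun hl => ?_⟩
  by_cases h : ∃ j, x ∈ B j
  · obtain ⟨j, hj⟩ := h
    rcases eq_or_ne j l with rfl | hjl
    · exact hj
    · exact (Set.disjoint_left.1 (disjoint_strictDemand hjl) (hmem j hj) hl).elim
  · have h0 := hs.2 (not_exists.1 h)
    rw [hx, surplus_of_mem_strictDemand hl] at h0
    exact (hl.1.ne' h0).elim

end Duality

/-- Differences of maxima over disjoint families inherit null level sets. -/
lemma measure_sup'_sub_sup'_eq_zero {X ι : Type*} [MeasurableSpace X] {μ : Measure X}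
    {ψ : ι → X → ℝ} (htwist : ∀ i j, i ≠ j → ∀ r : ℝ, μ {x | ψ i x - ψ j x = r} = 0)
    {s t : Finset ι} (hs : s.Nonempty) (ht : t.Nonempty) (hst : Disjoint s t) (r : ℝ) :
    μ {x | (s.sup' hs fun i => ψ i x) - (t.sup' ht fun i => ψ i x) = r} = 0 := by
  refine measure_mono_null (t := ⋃ i ∈ s, ⋃ j ∈ t, {x | ψ i x - ψ j x = r}) ?_ ?_
  · intro x hx
    obtain ⟨i, hi, hi'⟩ := s.exists_mem_eq_sup' hs fun i => ψ i x
    obtain ⟨j, hj, hj'⟩ := t.exists_mem_eq_sup' ht fun i => ψ i x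
    simp only [Set.mem_ofPred_eq, hi', hj'] at hx
    exact Set.mem_biUnion hi (Set.mem_biUnion hj hx)
  · refine (measure_biUnion_null_iff s.countable_toSet).2 fun i hi =>
      (measure_biUnion_null_iff t.countable_toSet).2 fun j hj => htwist i j ?_ r
    rintro rfl
    exact Finset.disjoint_left.1 hst hi hj

/-- A maximum of functions with null level sets has null level sets. -/
lemma measure_sup'_eq_zero {X ι : Type*} [MeasurableSpace X] {μ : Measure X}
    {ψ : ι → X → ℝ} (hlevel : ∀ i (r : ℝ), μ {x | ψ i x = r} = 0)
    {s : Finset ι} (hs : s.Nonempty) (r : ℝ) :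
    μ {x | (s.sup' hs fun i => ψ i x) = r} = 0 := by
  refine measure_mono_null (t := ⋃ i ∈ s, {x | ψ i x = r}) ?_
    ((measure_biUnion_null_iff s.countable_toSet).2 fun i _ => hlevel i r)
  intro x hx
  obtain ⟨i, hi, hi'⟩ := s.exists_mem_eq_sup' hs fun i => ψ i x
  simp only [Set.mem_ofPred_eq, hi'] at hx
  exact Set.mem_biUnion hi hx

/-- Proposition `propcoal`: duality for the coalition game. -/
theorem coalition_duality
    {X : Type*} [TopologicalSpace X] [CompactSpace X] [T2Space X]
    [MeasurableSpace X] [BorelSpace X]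
    (μ : Measure X) [IsProbabilityMeasure μ]
    {N : ℕ} (hN : 1 ≤ N)
    (ψ : Fin N → X → ℝ) (hψc : ∀ i, Continuous (ψ i))
    (hpos : ∀ i, μ {x | ψ i x ≤ 0} = 0)
    (htwist : ∀ i j, i ≠ j → ∀ r : ℝ, μ {x | ψ i x - ψ j x = r} = 0)
    (hiii : ∀ i (r : ℝ), μ {x | ψ i x = r} = 0)
    (M : Fin N → ℝ) (hM : ∀ i, 0 < M i) (hsat : ∑ i, M i ≤ 1)
    {k : ℕ} (J : Fin k → Finset (Fin N)) (hJne : ∀ l, (J l).Nonempty)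
    (hJdisj : Pairwise fun l l' => Disjoint (J l) (J l'))
    (hJcover : ∀ i : Fin N, ∃ l, i ∈ J l) :
    ∀ (ψJ : Fin k → X → ℝ) (MJ : Fin k → ℝ),
      (ψJ = fun l x => (J l).sup' (hJne l) fun i => ψ i x) →
      (MJ = fun l => ∑ i ∈ J l, M i) →
      -- (a) the coalition wisdoms inherit the non-degeneracy assumptions
      ((∀ l l', l ≠ l' → ∀ r : ℝ, μ {x | ψJ l x - ψJ l' x = r} = 0) ∧
       (∀ l (r : ℝ), μ {x | ψJ l x = r} = 0)) ∧
      -- (b) duality, the minimum being attained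
      (∃ q₀ : Fin k → ℝ,
        (∀ q, Xi0 μ ψJ q₀ + ∑ l, q₀ l * MJ l ≤ Xi0 μ ψJ q + ∑ l, q l * MJ l) ∧
        SigmaOpt μ ψJ MJ = Xi0 μ ψJ q₀ + ∑ l, q₀ l * MJ l) ∧
      -- (c) uniqueness up to μ-null sets of the optimal coalition partition
      (∀ A B : Fin k → Set X,
        Feasible μ MJ A → totalProfit μ ψJ A = SigmaOpt μ ψJ MJ →
        Feasible μ MJ B → totalProfit μ ψJ B = SigmaOpt μ ψJ MJ →
        ∀ l, μ (symmDiff (A l) (B l)) = 0) := by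
  rintro φ m hφdef hmdef
  have htwist' : ∀ l l', l ≠ l' → ∀ r : ℝ, μ {x | φ l x - φ l' x = r} = 0 := by
    subst hφdef
    exact fun l l' hl r => measure_sup'_sub_sup'_eq_zero htwist (hJne l) (hJne l') (hJdisj hl) r
  have hlevel' : ∀ l (r : ℝ), μ {x | φ l x = r} = 0 := by
    subst hφdef
    exact fun l r => measure_sup'_eq_zero hiii (hJne l) r
  have hφ : ∀ l, Continuous (φ l) := by
    subst hφdef
    exact fun l => Continuous.finset_sup'_apply (hJne l) fun i _ => hψc i
  have hpos' : ∀ l, μ {x | φ l x ≤ 0} = 0 := by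
    subst hφdef
    intro l
    obtain ⟨i, hi⟩ := hJne l
    exact measure_mono_null (fun x hx => (Finset.le_sup' (fun i => ψ i x) hi).trans hx) (hpos i)
  have hm : ∀ l, 0 ≤ m l := by
    subst hmdef
    exact fun l => Finset.sum_nonneg fun i _ => (hM i).le
  have hsum : ∑ l, m l ≤ 1 := by
    subst hmdef
    have hcover : Finset.univ.biUnion J = Finset.univ := by
      ext i
      simpa using hJcover i
    rw [← Finset.sum_biUnion fun l _ l' _ hl => hJdisj hl, hcover]
    exact hsat
  obtain ⟨l₀, -⟩ := hJcover ⟨0, hN⟩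
  have : Nonempty (Fin k) := ⟨l₀⟩
  obtain ⟨q₀, hq₀, hmin⟩ := exists_nonneg_dual_minimizer hφ hpos' hm hsum
  have htie := ae_no_tie htwist' hlevel' q₀
  have hA := measureReal_strictDemand_of_minimizer hφ htie hmin
  have hSigma : SigmaOpt μ φ m = Xi0 μ φ q₀ + ∑ l, q₀ l * m l := by
    refine IsGreatest.csSup_eq ⟨⟨strictDemand φ q₀, feasible_strictDemand hφ hA,
      (totalProfit_strictDemand hφ htie hA).symm⟩, ?_⟩
    rintro s ⟨B, hB, rfl⟩
    exact totalProfit_le_dual hφ hm hq₀ hB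
  refine ⟨⟨htwist', hlevel'⟩, ⟨q₀, hmin, hSigma⟩, fun A B hA hA' hB hB' l => ?_⟩
  rw [measure_symmDiff_eq_zero_iff]
  filter_upwards [ae_mem_iff_of_totalProfit_eq hφ hm hq₀ htie hA (hA'.trans hSigma),
    ae_mem_iff_of_totalProfit_eq hφ hm hq₀ htie hB (hB'.trans hSigma)] with x hxA hxB
  exact propext ((hxA l).trans (hxB l).symm)
end
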